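/- Let A, B ∈ Sym(n,ℝ) be linearly independent and form a non-dissipative pair with maxrank{A,B} ≥ 9. The following are equivalent: (i) there is a connected component of 𝒩 which does not span ℝⁿ; (ii) no connected component of 𝒩 spans ℝⁿ; (iii) minrank{A,B} = 2. -/

import Mathlib

open Matrix

section Bilinear

variable {E : Type*} [AddCommGroup E] [Module ℝ E]

theorem exists_roots_of_neg {a c : ℝ} (b : ℝ) (ha : 0 < a) (hc : c < 0) :
    ∃ s t : ℝ, 0 < s ∧ t < 0 ∧ a + 2 * b * s + c * s ^ 2 = 0 ∧ a + 2 * b * t + c * t ^ 2 = 0 ∧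
      c * (s * t) = a := by
  have hpos : 0 < b ^ 2 - a * c := by nlinarith [sq_nonneg b, mul_pos ha (neg_pos.2 hc)]
  set D := √(b ^ 2 - a * c) with hD
  have hD2 : D ^ 2 = b ^ 2 - a * c := Real.sq_sqrt hpos.le
  have hbD : |b| < D := by
    apply Real.lt_sqrt_of_sq_lt
    rw [sq_abs]
    nlinarith [mul_pos ha (neg_pos.2 hc)]
  obtain ⟨h1, h2⟩ := abs_lt.1 hbD
  refine ⟨(-b - D) / c, (-b + D) / c, div_pos_of_neg_of_neg (by linarith) hc,
    div_neg_of_pos_of_neg (by linarith) hc, ?_, ?_, ?_⟩ <;> field_simp [hc.ne] <;> nlinarith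

theorem exists_isotropic_pair {f : LinearMap.BilinForm ℝ E} (hf : ∀ x y, f x y = f y x) {x y : E}
    (hx : 0 < f x x) (hy : f y y < 0) :
    ∃ s t : ℝ, 0 < s ∧ t < 0 ∧ f (x + s • y) (x + s • y) = 0 ∧ f (x + t • y) (x + t • y) = 0 ∧
      f (x + s • y) (x + t • y) ≠ 0 ∧ f y y * (s * t) = f x x := by
  obtain ⟨s, t, hs, ht, h1, h2, h3⟩ := exists_roots_of_neg (f x y) hx hy
  refine ⟨s, t, hs, ht, ?_, ?_, ?_, h3⟩
  · simp [hf y x]; linarith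
  · simp [hf y x]; linarith
  · simp [hf y x]
    intro h
    have h4 : (s - t) * (f x y + f y y * t) = 0 := by linarith
    have h5 : f x y + f y y * t = 0 := by
      rcases mul_eq_zero.1 h4 with h | h
      · linarith
      · exact h
    have : 0 < f y y * t := mul_pos_of_neg_of_neg hy ht
    nlinarith

/-- Finsler's lemma. -/
theorem exists_nonneg_add_smul {f g : LinearMap.BilinForm ℝ E} (hf : ∀ x y, f x y = f y x)
    (hg : ∀ x y, g x y = g y x) (hpos : ∃ x, 0 < f x x) (hneg : ∃ y, f y y < 0)
    (h : ∀ x, f x x = 0 → 0 ≤ g x x) : ∃ c : ℝ, ∀ x, 0 ≤ g x x + c * f x x := by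
  have key : ∀ x y, 0 < f x x → f y y < 0 → - g x x / f x x ≤ g y y / (- f y y) := by
    intro x y hx hy
    obtain ⟨s, t, hs, ht, h1, h2, -, h3⟩ := exists_isotropic_pair hf hx hy
    have k1 := h _ h1
    have k2 := h _ h2
    simp only [map_add, LinearMap.add_apply, map_smul, LinearMap.smul_apply, smul_eq_mul,
      hg y x] at k1 k2
    have k3 : 0 ≤ (s - t) * (g x x - s * t * g y y) := by
      nlinarith [mul_nonneg (neg_nonneg.2 ht.le) k1, mul_nonneg hs.le k2]
    have k4 : 0 ≤ g x x - s * t * g y y := nonneg_of_mul_nonneg_right k3 (by linarith)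
    rw [div_le_div_iff₀ hx (by linarith), ← h3]
    nlinarith [mul_nonneg (neg_nonneg.2 hy.le) k4]
  obtain ⟨x₀, hx₀⟩ := hpos
  obtain ⟨y₀, hy₀⟩ := hneg
  set S : Set ℝ := {r | ∃ x, 0 < f x x ∧ - g x x / f x x = r} with hS
  have hbdd : ∀ y, f y y < 0 → g y y / (- f y y) ∈ upperBounds S := by
    rintro y hy _ ⟨x, hx, rfl⟩
    exact key x y hx hy
  refine ⟨sSup S, fun x => ?_⟩
  rcases lt_trichotomy (f x x) 0 with hx | hx | hx
  · have := csSup_le (s := S) ⟨_, x₀, hx₀, rfl⟩ (hbdd x hx)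
    rw [le_div_iff₀ (by linarith)] at this
    linarith
  · simpa [hx] using h x hx
  · have := le_csSup (s := S) ⟨_, hbdd y₀ hy₀⟩ ⟨x, hx, rfl⟩
    rw [div_le_iff₀ hx] at this
    linarith

/-- The isotropic vectors outside the radical of an indefinite form are not contained in a
hyperplane. -/
theorem exists_isotropic_apply_ne_zero {f : LinearMap.BilinForm ℝ E} (hf : ∀ x y, f x y = f y x)
    (hpos : ∃ x, 0 < f x x) (hneg : ∃ y, f y y < 0) {p : E →ₗ[ℝ] ℝ} (hp : p ≠ 0) :
    ∃ v, f v v = 0 ∧ f v ≠ 0 ∧ p v ≠ 0 := by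
  by_contra! hcon
  obtain ⟨y, hy⟩ := hneg
  have hx : ∀ x, 0 < f x x → p x = 0 := by
    intro x hx
    obtain ⟨s, t, hs, ht, h1, h2, h3, -⟩ := exists_isotropic_pair hf hx hy
    have k1 := hcon _ h1 (fun h => h3 (by rw [h]; rfl))
    have k2 := hcon _ h2 (fun h => h3 (by rw [hf, h]; rfl))
    simp only [map_add, map_smul, smul_eq_mul] at k1 k2
    have : (s - t) * p x = 0 := by linear_combination s * k2 - t * k1
    exact (mul_eq_zero.1 this).resolve_left (by linarith)
  obtain ⟨x, hx0⟩ := hpos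
  refine hp (LinearMap.ext fun w => ?_)
  set M := (|f w w| + 2 * |f w x| + 1) / f x x with hM
  have hMx : M * f x x = |f w w| + 2 * |f w x| + 1 := by rw [hM]; field_simp
  have hM0 : 0 < M := by rw [hM]; positivity
  have h1 : 0 < f (w + (1 + M) • x) (w + (1 + M) • x) := by
    simp only [map_add, LinearMap.add_apply, map_smul, LinearMap.smul_apply, smul_eq_mul, hf x w]
    have e : (1 + M) * ((1 + M) * f x x) = (1 + M) * f x x + (1 + M) * (|f w w| + 2 * |f w x| + 1) := by
      rw [← hMx]; ring
    have h2 : 0 ≤ M * (|f w w| + 1) := by positivity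
    have h3 : 0 ≤ (1 + M) * (|f w x| + f w x) :=
      mul_nonneg (by linarith) (by linarith [neg_abs_le (f w x)])
    have h4 : 0 ≤ (1 + M) * f x x := by positivity
    nlinarith [neg_abs_le (f w w)]
  have h2 := hx _ h1
  simpa [hx x hx0] using h2

theorem exists_orthogonal_apply_self_ne_zero {f : LinearMap.BilinForm ℝ E}
    (hf : ∀ x y, f x y = f y x) {x y : E} (hx : f x x = 0) (hy : f y y = 0) (hxy : f x y ≠ 0)
    (hrad : ∃ w, f x w = 0 ∧ f y w = 0 ∧ f w ≠ 0) : ∃ w, f x w = 0 ∧ f y w = 0 ∧ f w w ≠ 0 := by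
  obtain ⟨w, h1, h2, h3⟩ := hrad
  by_contra! hcon
  refine h3 (LinearMap.ext fun v => ?_)
  set v' := v - (f v y / f x y) • x - (f v x / f x y) • y with hv'
  have e1 : f x v' = 0 := by
    simp [hv', hx, hf x v]; field_simp; ring
  have e2 : f y v' = 0 := by
    simp [hv', hy, hf y v, hf y x]; field_simp; ring
  have k1 := hcon w h1 h2
  have k2 := hcon v' e1 e2
  have k3 := hcon (w + v') (by simp [h1, e1]) (by simp [h2, e2])
  have k4 : f w v' = 0 := by
    simp only [map_add, LinearMap.add_apply, k1, k2, hf v' w] at k3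
    linarith
  simpa [hv', hf w x, hf w y, h1, h2] using k4

/-- By Finsler's lemma `g` takes both signs on the isotropic cone of `f`; two isotropic vectors of `f`
are joined by a conic in this cone, which then contains a zero of `g` off the common radical. -/
theorem exists_common_zero {f g : LinearMap.BilinForm ℝ E} (hf : ∀ x y, f x y = f y x)
    (hg : ∀ x y, g x y = g y x)
    (hnd : ∀ a b : ℝ, (∀ x, 0 ≤ a * f x x + b * g x x) → a = 0 ∧ b = 0)
    (hrad : ∀ x y, ∃ w, f x w = 0 ∧ f y w = 0 ∧ f w ≠ 0) :
    ∃ z, f z z = 0 ∧ g z z = 0 ∧ (f z ≠ 0 ∨ g z ≠ 0) := by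
  have hneg : ∃ y, f y y < 0 := by
    by_contra! h
    simpa using hnd 1 0 (by simpa using h)
  have hpos : ∃ x, 0 < f x x := by
    by_contra! h
    simpa using hnd (-1) 0 (by simpa using h)
  obtain ⟨x, hfx, hgx⟩ : ∃ x, f x x = 0 ∧ g x x < 0 := by
    by_contra! h
    obtain ⟨c, hc⟩ := exists_nonneg_add_smul hf hg hpos hneg h
    simpa using hnd c 1 (fun x => by linarith [hc x])
  obtain ⟨y, hfy, hgy⟩ : ∃ y, f y y = 0 ∧ 0 < g y y := by
    by_contra! h
    obtain ⟨c, hc⟩ := exists_nonneg_add_smul (g := -g) hf (fun x y => by simp [hg x y]) hpos hneg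
      (fun x hx => by simpa using h x hx)
    simpa using hnd c (-1) (fun x => by have := hc x; simp at this; linarith)
  by_cases hxy : f x y = 0
  · obtain ⟨s, -, hs, -, h1, -, -⟩ := exists_roots_of_neg (g x y) hgy hgx
    refine ⟨y + s • x, by simp [hfx, hfy, hxy, hf y x], by simp [hg y x]; linarith, ?_⟩
    right
    intro h
    have h2 : g (y + s • x) x = 0 := by rw [h]; rfl
    have h3 : g (y + s • x) y = 0 := by rw [h]; rfl
    simp [hg y x] at h2 h3
    have h4 : g y y = s * s * g x x := by linear_combination h3 - s * h2
    nlinarith [mul_pos hs hs]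
  · obtain ⟨w, hxw, hyw, hww⟩ := exists_orthogonal_apply_self_ne_zero hf hfx hfy hxy (hrad x y)
    obtain ⟨y', hfy', hgy', hxy', hyw', hsign⟩ : ∃ y', f y' y' = 0 ∧ 0 < g y' y' ∧ f x y' ≠ 0 ∧
        f y' w = 0 ∧ 0 ≤ -(2 * f x y') / f w w := by
      rcases le_total 0 (-(2 * f x y) / f w w) with h | h
      · exact ⟨y, hfy, hgy, hxy, hyw, h⟩
      · refine ⟨-y, by simpa using hfy, by simpa using hgy, by simpa using hxy,
          by simpa using hyw, ?_⟩
        have : -(2 * f x (-y)) / f w w = - (-(2 * f x y) / f w w) := by simp; ring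
        linarith
    set c := √(-(2 * f x y') / f w w) with hc
    have hc2 : c ^ 2 * f w w = -(2 * f x y') := by
      rw [hc, Real.sq_sqrt hsign]; field_simp
    set γ : ℝ → E := fun r => (1 - r) ^ 2 • x + r ^ 2 • y' + (c * (r * (1 - r))) • w with hγ
    have hfγ : ∀ r, f (γ r) (γ r) = 0 := by
      intro r
      simp only [hγ, map_add, LinearMap.add_apply, map_smul, LinearMap.smul_apply, smul_eq_mul,
        hfx, hfy', hxw, hyw', hf y' x, hf w x, hf w y']
      linear_combination r ^ 2 * (1 - r) ^ 2 * hc2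
    have hcont : Continuous fun r => g (γ r) (γ r) := by
      simp only [hγ, map_add, LinearMap.add_apply, map_smul, LinearMap.smul_apply, smul_eq_mul]
      fun_prop
    obtain ⟨r, -, hr⟩ := intermediate_value_Icc (zero_le_one' ℝ) hcont.continuousOn
      (show (0 : ℝ) ∈ _ by simp [hγ]; constructor <;> linarith)
    refine ⟨γ r, hfγ r, hr, Or.inl fun h => ?_⟩
    have h1 : f (γ r) x = 0 := by rw [h]; rfl
    have h2 : f (γ r) y' = 0 := by rw [h]; rfl
    simp [hγ, hfx, hfy', hxy', hf w x, hf w y', hf y' x, hxw, hyw'] at h1 h2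
    rw [h1] at h2
    norm_num at h2

theorem exists_regular_zero {f g : LinearMap.BilinForm ℝ E} (hf : ∀ x y, f x y = f y x)
    (hg : ∀ x y, g x y = g y x)
    (hnd : ∀ a b : ℝ, (∀ x, 0 ≤ a * f x x + b * g x x) → a = 0 ∧ b = 0)
    (hrad : ∀ x y, ∃ w, f x w = 0 ∧ f y w = 0 ∧ f w ≠ 0) :
    ∃ z, f z z = 0 ∧ g z z = 0 ∧ LinearIndependent ℝ ![f z, g z] := by
  obtain ⟨z, hfz, hgz, hz⟩ := exists_common_zero hf hg hnd hrad
  by_cases hli : LinearIndependent ℝ ![f z, g z]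
  · exact ⟨z, hfz, hgz, hli⟩
  rw [LinearIndependent.pair_iff] at hli
  push Not at hli
  obtain ⟨a, b, hab, hne⟩ := hli
  have hab0 : 0 < a ^ 2 + b ^ 2 := by
    rcases eq_or_ne a 0 with h | h
    · have := hne h
      positivity
    · positivity
  set F : LinearMap.BilinForm ℝ E := a • f + b • g with hF
  set G : LinearMap.BilinForm ℝ E := -b • f + a • g with hG
  have hFz : ∀ v, F z v = 0 := fun v => by
    have := LinearMap.congr_fun hab v
    simpa [hF] using this
  have hfFG : ∀ u v, (a ^ 2 + b ^ 2) * f u v = a * F u v - b * G u v := fun u v => by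
    simp [hF, hG]; ring
  have hgFG : ∀ u v, (a ^ 2 + b ^ 2) * g u v = b * F u v + a * G u v := fun u v => by
    simp [hF, hG]; ring
  have hFs : ∀ u v, F u v = F v u := fun u v => by simp [hF, hf u v, hg u v]
  have hGs : ∀ u v, G u v = G v u := fun u v => by simp [hG, hf u v, hg u v]
  have hGz : G z ≠ 0 := by
    intro h
    have hG0 : ∀ v, G z v = 0 := fun v => by rw [h]; rfl
    rcases hz with hz | hz <;> refine hz (LinearMap.ext fun v => ?_)
    · have := hfFG z v
      rw [hFz, hG0] at this
      simpa [hab0.ne'] using this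
    · have := hgFG z v
      rw [hFz, hG0] at this
      simpa [hab0.ne'] using this
  have hneg : ∃ y, F y y < 0 := by
    by_contra! h
    obtain ⟨h1, h2⟩ := hnd a b (fun x => by simpa [hF] using h x)
    simp [h1, h2] at hab0
  have hpos : ∃ y, 0 < F y y := by
    by_contra! h
    obtain ⟨h1, h2⟩ := hnd (-a) (-b) (fun x => by have := h x; simp [hF] at this; linarith)
    simp at h1 h2
    simp [h1, h2] at hab0
  obtain ⟨v, hv1, hv2, hv3⟩ := exists_isotropic_apply_ne_zero hFs hpos hneg hGz
  have hGzz : G z z = 0 := by simp [hG, hfz, hgz]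
  -- The point `w` lies on the line through `z` and `v`, including its point at infinity `v`.
  set w := G v v • z - (2 * G z v) • v with hw
  have hFw : F w w = 0 := by simp [hw, hv1, hFz, hFs v z]
  have hGw : G w w = 0 := by
    simp [hw, hGzz, hGs v z]; ring
  refine ⟨w, ?_, ?_, ?_⟩
  · have := hfFG w w
    rw [hFw, hGw] at this
    simpa [hab0.ne'] using this
  · have := hgFG w w
    rw [hFw, hGw] at this
    simpa [hab0.ne'] using this
  · rw [LinearIndependent.pair_iff]
    intro s t hst
    have h0 : ∀ u, s * f w u + t * g w u = 0 := fun u => by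
      simpa using LinearMap.congr_fun hst u
    have h1 : ∀ u, (s * a + t * b) * F w u + (t * a - s * b) * G w u = 0 := fun u => by
      linear_combination (a ^ 2 + b ^ 2) * h0 u - s * hfFG w u - t * hgFG w u
    have h2 := h1 z
    have h3 : t * a - s * b = 0 := by
      have e1 : F w z = 0 := by rw [hFs, hFz]
      have e2 : G w z = - 2 * G z v ^ 2 := by simp [hw, hGzz, hGs v z]; ring
      rw [e1, e2] at h2
      have : (t * a - s * b) * G z v ^ 2 = 0 := by linarith
      simpa [hv3] using this
    have h4 : s * a + t * b = 0 := by
      by_contra hne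
      refine hv2 (LinearMap.ext fun u => ?_)
      have h5 := h1 u
      rw [h3] at h5
      have h6 : F w u = 0 := by simpa [hne] using h5
      have : G z v * F v u = 0 := by simpa [hw, hFz] using h6
      simpa [hv3] using this
    constructor
    · have : (a ^ 2 + b ^ 2) * s = 0 := by linear_combination a * h4 - b * h3
      simpa [hab0.ne'] using this
    · have : (a ^ 2 + b ^ 2) * t = 0 := by linear_combination b * h4 + a * h3
      simpa [hab0.ne'] using this

end Bilinear

section Dual

variable {E : Type*} [AddCommGroup E] [Module ℝ E]

theorem exists_dual_pair {p r : E →ₗ[ℝ] ℝ} (h : LinearIndependent ℝ ![p, r]) :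
    ∃ u v, p u = 1 ∧ r u = 0 ∧ p v = 0 ∧ r v = 1 := by
  have key : ∀ p r : E →ₗ[ℝ] ℝ, LinearIndependent ℝ ![p, r] → ∃ u, p u = 1 ∧ r u = 0 := by
    intro p r h
    obtain ⟨u, hu, hpu⟩ : ∃ u, r u = 0 ∧ p u ≠ 0 := by
      by_contra! hcon
      have h1 : p ∈ Submodule.span ℝ (Set.range fun _ : Unit => r) :=
        mem_span_of_iInf_ker_le_ker (fun u hu => hcon u (by simpa using hu))
      rw [Set.range_const, Submodule.mem_span_singleton] at h1
      obtain ⟨c, hc⟩ := h1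
      have := LinearIndependent.pair_iff.1 h 1 (-c) (by simp [← hc])
      simp at this
    exact ⟨(p u)⁻¹ • u, by simp [hpu], by simp [hu]⟩
  obtain ⟨u, hu1, hu2⟩ := key p r h
  obtain ⟨v, hv1, hv2⟩ := key r p (LinearIndependent.pair_symm_iff.1 h)
  exact ⟨u, v, hu1, hu2, hv2, hv1⟩

theorem linearIndependent_pair_of_det_ne_zero {p r : E →ₗ[ℝ] ℝ} {u v : E}
    (h : p u * r v - p v * r u ≠ 0) : LinearIndependent ℝ ![p, r] := by
  rw [LinearIndependent.pair_iff]
  intro s t hst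
  have h1 : s * p u + t * r u = 0 := by simpa using LinearMap.congr_fun hst u
  have h2 : s * p v + t * r v = 0 := by simpa using LinearMap.congr_fun hst v
  constructor
  · have : s * (p u * r v - p v * r u) = 0 := by linear_combination r v * h1 - r u * h2
    exact (mul_eq_zero.1 this).resolve_right h
  · have : t * (p u * r v - p v * r u) = 0 := by linear_combination p u * h2 - p v * h1
    exact (mul_eq_zero.1 this).resolve_right h

theorem mem_span_pair_of_ker {p r ℓ : E →ₗ[ℝ] ℝ} (h : ∀ x, p x = 0 → r x = 0 → ℓ x = 0) :
    ∃ a b : ℝ, ℓ = a • p + b • r := by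
  have h1 : ℓ ∈ Submodule.span ℝ (Set.range ![p, r]) :=
    mem_span_of_iInf_ker_le_ker (fun u hu => by
      simp [Fin.forall_fin_two] at hu
      exact h u hu.1 hu.2)
  rw [Matrix.range_cons_cons_empty, Submodule.mem_span_pair] at h1
  obtain ⟨a, b, hab⟩ := h1
  exact ⟨a, b, hab.symm⟩

theorem range_le_span_of_ker {f : LinearMap.BilinForm ℝ E} (hf : ∀ x y, f x y = f y x) {x y : E}
    (h : ∀ w, f x w = 0 → f y w = 0 → f w = 0) :
    LinearMap.range f ≤ Submodule.span ℝ ({f x, f y} : Set (E →ₗ[ℝ] ℝ)) := by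
  rintro _ ⟨v, rfl⟩
  obtain ⟨a, b, hab⟩ := mem_span_pair_of_ker (p := f x) (r := f y) (ℓ := f v)
    (fun w h1 h2 => by rw [hf, h w h1 h2]; rfl)
  exact Submodule.mem_span_pair.2 ⟨a, b, hab.symm⟩

theorem finrank_range_le_two_of_ker {f : LinearMap.BilinForm ℝ E}
    (hf : ∀ x y, f x y = f y x) {x y : E} (h : ∀ w, f x w = 0 → f y w = 0 → f w = 0) :
    Module.finrank ℝ (LinearMap.range f) ≤ 2 := by
  classical
  have hle := range_le_span_of_ker hf h
  rw [← Finset.coe_pair] at hle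
  refine (Submodule.finrank_mono hle).trans ?_
  exact (finrank_span_finset_le_card _).trans Finset.card_le_two

theorem finrank_range_le_two_of_hyperplane {f : LinearMap.BilinForm ℝ E} {p : E →ₗ[ℝ] ℝ} {u : E}
    (hu : p u = 1) (h : ∀ x y, p x = 0 → p y = 0 → f x y = 0) :
    Module.finrank ℝ (LinearMap.range f) ≤ 2 := by
  classical
  have hle : LinearMap.range f ≤ Submodule.span ℝ (({f u, p} : Finset _) : Set _) := by
    rw [Finset.coe_pair]
    rintro _ ⟨v, rfl⟩
    obtain ⟨a, b, hab⟩ := mem_span_pair_of_ker (p := p) (r := p) (ℓ := f (v - p v • u))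
      (fun w h1 _ => h _ _ (by simp [hu]) h1)
    refine Submodule.mem_span_pair.2 ⟨p v, a + b, ?_⟩
    rw [map_sub, map_smul] at hab
    rw [eq_comm, ← sub_eq_iff_eq_add', hab, add_smul]
  refine (Submodule.finrank_mono hle).trans ?_
  exact (finrank_span_finset_le_card _).trans Finset.card_le_two

theorem finrank_range_le_four_of_codim_two {f : LinearMap.BilinForm ℝ E} {p r : E →ₗ[ℝ] ℝ}
    {u v : E} (hpu : p u = 1) (hru : r u = 0) (hpv : p v = 0) (hrv : r v = 1)
    (h : ∀ x y, p x = 0 → r x = 0 → p y = 0 → r y = 0 → f x y = 0) :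
    Module.finrank ℝ (LinearMap.range f) ≤ 4 := by
  classical
  have hle : LinearMap.range f ≤ Submodule.span ℝ (({f u, f v, p, r} : Finset _) : Set _) := by
    rintro _ ⟨x, rfl⟩
    obtain ⟨a, b, hab⟩ := mem_span_pair_of_ker (p := p) (r := r) (ℓ := f (x - p x • u - r x • v))
      (fun w h1 h2 => h _ _ (by simp [hpu, hpv]) (by simp [hru, hrv]) h1 h2)
    have e : f x = p x • f u + r x • f v + a • p + b • r := by
      simp only [map_sub, map_smul] at hab
      rw [add_assoc, ← hab]; abel
    rw [e]
    refine add_mem (add_mem (add_mem ?_ ?_) ?_) ?_ <;>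
      exact Submodule.smul_mem _ _ (Submodule.subset_span (by simp))
  refine (Submodule.finrank_mono hle).trans ?_
  exact (finrank_span_finset_le_card _).trans Finset.card_le_four

theorem polarization {f : LinearMap.BilinForm ℝ E} (hf : ∀ x y, f x y = f y x) {S : Submodule ℝ E}
    (h : ∀ x ∈ S, f x x = 0) {x y : E} (hx : x ∈ S) (hy : y ∈ S) : f x y = 0 := by
  have := h (x + y) (add_mem hx hy)
  simp only [map_add, LinearMap.add_apply, h x hx, h y hy, hf y x] at this
  linarith

end Dual

section Local

open Filter Topology

variable {E : Type*} [NormedAddCommGroup E] [NormedSpace ℝ E] [FiniteDimensional ℝ E]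

theorem continuous_apply_self (f : LinearMap.BilinForm ℝ E) :
    Continuous fun x : E × E => f x.1 x.2 := by
  have : Continuous fun x : E × E => f.toContinuousBilinearMap x.1 x.2 := by fun_prop
  simpa using this

/-- The regular common zeros of two quadratic forms, given by their polar forms. -/
def regularZeros (f g : LinearMap.BilinForm ℝ E) : Set E :=
  {z | f z z = 0 ∧ g z z = 0 ∧ LinearIndependent ℝ ![f z, g z]}

theorem exists_curve {f g : LinearMap.BilinForm ℝ E} (hf : ∀ x y, f x y = f y x)
    (hg : ∀ x y, g x y = g y x) {z v : E} (hz : z ∈ regularZeros f g) (hfv : f z v = 0)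
    (hgv : g z v = 0) :
    ∃ γ : ℝ → E, γ 0 = z ∧ HasDerivAt γ v 0 ∧
      ∀ᶠ ε in 𝓝 0, γ ε ∈ connectedComponentIn (regularZeros f g) z := by
  obtain ⟨hfz, hgz, hli⟩ := hz
  obtain ⟨u, w, hfu, hgu, hfw, hgw⟩ := exists_dual_pair hli
  have hq : ∀ (f : LinearMap.BilinForm ℝ E), (∀ x y, f x y = f y x) →
      HasStrictFDerivAt (fun x => f x x) ((2 : ℝ) • f.toContinuousBilinearMap z) z := by
    intro f hf
    have := (f.toContinuousBilinearMap.hasStrictFDerivAt (x := z)).clm_apply (hasStrictFDerivAt_id z)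
    refine this.congr_fderiv ?_
    ext y
    simp [hf y z]
    ring
  have hQ := (hq f hf).prodMk (hq g hg)
  set Q : E → ℝ × ℝ := fun x => (f x x, g x x) with hQdef
  set Q' := ((2 : ℝ) • f.toContinuousBilinearMap z).prod ((2 : ℝ) • g.toContinuousBilinearMap z)
    with hQ'
  have hsurj : (Q' : E →ₗ[ℝ] ℝ × ℝ).range = ⊤ := by
    rw [LinearMap.range_eq_top]
    rintro ⟨a, b⟩
    refine ⟨(a / 2) • u + (b / 2) • w, ?_⟩
    simp [hQ', hfu, hgu, hfw, hgw]
    constructor <;> ring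
  have hvker : v ∈ (Q' : E →ₗ[ℝ] ℝ × ℝ).ker := by simp [hQ', hfv, hgv]
  set φ := HasStrictFDerivAt.implicitFunction Q Q' hQ hsurj with hφ
  set V : (Q' : E →ₗ[ℝ] ℝ × ℝ).ker := ⟨v, hvker⟩ with hV
  set γ : ℝ → E := fun ε => φ (Q z) (ε • V) with hγ
  have hQz : Q z = 0 := by simp [hQdef, hfz, hgz]
  have hγ0 : γ 0 = z := by
    simp only [hγ, zero_smul]
    exact hQ.implicitFunction_apply_image hsurj
  have hlin : HasStrictDerivAt (fun ε : ℝ => ε • V) V 0 := by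
    simpa using (hasStrictDerivAt_id (0 : ℝ)).smul_const V
  have hder : HasStrictDerivAt γ v 0 := by
    have h1 := hQ.to_implicitFunction hsurj
    have h2 : HasStrictFDerivAt (φ (Q z)) (Q' : E →ₗ[ℝ] ℝ × ℝ).ker.subtypeL ((0 : ℝ) • V) := by
      rw [zero_smul]; exact h1
    exact h2.comp_hasStrictDerivAt (0 : ℝ) hlin
  have hcont0 : ContinuousAt γ 0 := hder.hasDerivAt.continuousAt
  have hzero : ∀ᶠ ε in 𝓝 (0 : ℝ), Q (γ ε) = 0 := by
    have h1 := hQ.map_implicitFunction_eq hsurj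
    have h2 : Tendsto (fun ε : ℝ => (Q z, ε • V)) (𝓝 0) (𝓝 (Q z, 0)) := by
      have : Continuous (fun ε : ℝ => (Q z, ε • V)) := by fun_prop
      simpa using this.tendsto 0
    filter_upwards [h2.eventually h1] with ε hε
    rw [← hQz]; exact hε
  have hdet : ∀ᶠ ε in 𝓝 (0 : ℝ), f (γ ε) u * g (γ ε) w - f (γ ε) w * g (γ ε) u ≠ 0 := by
    have hc : ∀ (f : LinearMap.BilinForm ℝ E) (y : E), ContinuousAt (fun ε => f (γ ε) y) 0 :=
      fun f y => (continuous_apply_self f).continuousAt.comp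
        (f := fun ε => (γ ε, y)) (hcont0.prodMk continuousAt_const)
    refine ContinuousAt.eventually_ne (((hc f u).mul (hc g w)).sub ((hc f w).mul (hc g u))) ?_
    simp [hγ0, hfu, hgu, hfw, hgw]
  have hN : ∀ᶠ ε in 𝓝 (0 : ℝ), γ ε ∈ regularZeros f g := by
    filter_upwards [hzero, hdet] with ε h1 h2
    simp only [hQdef, Prod.mk_eq_zero] at h1
    exact ⟨h1.1, h1.2, linearIndependent_pair_of_det_ne_zero h2⟩
  obtain ⟨K, s, hs, hlip⟩ := hder.hasStrictFDerivAt.exists_lipschitzOnWith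
  obtain ⟨δ, hδ, hball⟩ := Metric.eventually_nhds_iff_ball.1 (hN.and hs)
  refine ⟨γ, hγ0, hder.hasDerivAt, ?_⟩
  have hsub : γ '' Metric.ball 0 δ ⊆ connectedComponentIn (regularZeros f g) z := by
    refine IsPreconnected.subset_connectedComponentIn ?_ ⟨0, by simpa using hδ, hγ0⟩ ?_
    · exact (convex_ball (0 : ℝ) δ).isPreconnected.image γ
        (hlip.continuousOn.mono fun ε hε => (hball ε hε).2)
    · rintro _ ⟨ε, hε, rfl⟩
      exact (hball ε hε).1
  filter_upwards [Metric.ball_mem_nhds 0 hδ] with ε hε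
  exact hsub ⟨ε, hε, rfl⟩

/-- If the common zeros of `f` and `g` near a regular common zero `z` lie in the hyperplane `f z = 0`,
then `f` vanishes on this hyperplane, or both forms vanish on the tangent space at `z`. -/
theorem vanish_of_curves {f g : LinearMap.BilinForm ℝ E} (hf : ∀ x y, f x y = f y x)
    (hg : ∀ x y, g x y = g y x) {z u : E} (hfz : f z z = 0) (hgz : g z z = 0)
    (hfu : f z u = 0) (hgu : g z u = 1)
    (hcurve : ∀ v, f z v = 0 → g z v = 0 → ∃ γ : ℝ → E, γ 0 = z ∧ HasDerivAt γ v 0 ∧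
      ∀ᶠ ε in 𝓝 0, f (γ ε) (γ ε) = 0 ∧ g (γ ε) (γ ε) = 0 ∧ f z (γ ε) = 0) :
    (∀ x, f z x = 0 → f x x = 0) ∨
      ∀ x, f z x = 0 → g z x = 0 → f x x = 0 ∧ g x x = 0 := by
  have hdir : ∀ v, f z v = 0 → g z v = 0 → ∃ d : ℝ → E, Tendsto d (𝓝[≠] 0) (𝓝 v) ∧
      ∀ᶠ ε in 𝓝[≠] 0, f z (d ε) = 0 ∧ f (d ε) (d ε) = 0 ∧
        2 * g z (d ε) + ε * g (d ε) (d ε) = 0 := by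
    intro v h1 h2
    obtain ⟨γ, hγ0, hder, hev⟩ := hcurve v h1 h2
    refine ⟨slope γ 0, hasDerivAt_iff_tendsto_slope.1 hder, ?_⟩
    filter_upwards [hev.filter_mono nhdsWithin_le_nhds, self_mem_nhdsWithin] with ε ⟨e1, e2, e3⟩ hε
    have hε0 : ε ≠ 0 := hε
    have hγε : γ ε = z + ε • slope γ 0 ε := by
      simp [slope_def_module, hε0, hγ0]
    set d := slope γ 0 ε
    rw [hγε] at e1 e2 e3
    simp only [map_add, LinearMap.add_apply, map_smul, LinearMap.smul_apply, smul_eq_mul, hfz, hgz,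
      hf d z, hg d z] at e1 e2 e3
    have k3 : f z d = 0 := by simpa [hε0] using e3
    refine ⟨k3, ?_, ?_⟩
    · rw [k3] at e1
      simpa [hε0] using e1
    · have : ε * (2 * g z d + ε * g d d) = 0 := by linarith
      simpa [hε0] using this
  have lim : ∀ (f : LinearMap.BilinForm ℝ E) {d e : ℝ → E} {v w : E}, Tendsto d (𝓝[≠] 0) (𝓝 v) →
      Tendsto e (𝓝[≠] 0) (𝓝 w) → Tendsto (fun ε => f (d ε) (e ε)) (𝓝[≠] 0) (𝓝 (f v w)) :=
    fun f _ _ _ _ hd he => ((continuous_apply_self f).tendsto (_, _)).comp (hd.prodMk_nhds he)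
  have hT : ∀ v, f z v = 0 → g z v = 0 → f v v = 0 := by
    intro v h1 h2
    obtain ⟨d, hd, hev⟩ := hdir v h1 h2
    exact tendsto_nhds_unique ((lim f hd hd).congr' (hev.mono fun ε h => h.2.1)) tendsto_const_nhds
  by_cases hgT : ∃ v, f z v = 0 ∧ g z v = 0 ∧ g v v ≠ 0
  swap
  · push Not at hgT
    exact Or.inr fun x h1 h2 => ⟨hT x h1 h2, hgT x h1 h2⟩
  left
  have hσ : ∀ v, f z v = 0 → g z v = 0 → g v v ≠ 0 → ∃ (τ : ℝ → E) (σ : ℝ → ℝ),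
      Tendsto τ (𝓝[≠] 0) (𝓝 v) ∧ Tendsto σ (𝓝[≠] 0) (𝓝 0) ∧
      ∀ᶠ ε in 𝓝[≠] 0, f z (τ ε) = 0 ∧ g z (τ ε) = 0 ∧ σ ε ≠ 0 ∧
        2 * f (τ ε) u + σ ε * f u u = 0 := by
    intro v h1 h2 h3
    obtain ⟨d, hd, hev⟩ := hdir v h1 h2
    have hσ0 : Tendsto (fun ε => g z (d ε)) (𝓝[≠] 0) (𝓝 0) := by
      simpa [h2] using lim g (tendsto_const_nhds (x := z)) hd
    refine ⟨fun ε => d ε - g z (d ε) • u, fun ε => g z (d ε), ?_, hσ0, ?_⟩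
    · simpa using hd.sub (hσ0.smul_const u)
    · filter_upwards [hev, self_mem_nhdsWithin, (lim g hd hd).eventually_ne h3] with
        ε ⟨e1, e2, e3⟩ hε hne
      have hε0 : ε ≠ 0 := hε
      have t1 : f z (d ε - g z (d ε) • u) = 0 := by simp [e1, hfu]
      have t2 : g z (d ε - g z (d ε) • u) = 0 := by simp [hgu]
      have t3 := hT _ t1 t2
      have s0 : g z (d ε) ≠ 0 := by
        intro h
        rw [h] at e3
        simp [hε0, hne] at e3
      refine ⟨t1, t2, s0, ?_⟩
      set σ := g z (d ε)
      obtain ⟨τ, hτ⟩ : ∃ τ, τ = d ε - σ • u := ⟨_, rfl⟩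
      rw [← hτ] at t3 ⊢
      rw [show d ε = τ + σ • u by rw [hτ]; abel] at e2
      simp only [map_add, LinearMap.add_apply, map_smul, LinearMap.smul_apply, smul_eq_mul, t3,
        hf u τ] at e2
      have : σ * (2 * f τ u + σ * f u u) = 0 := by linarith
      simpa [s0] using this
  have hu' : ∀ v, f z v = 0 → g z v = 0 → g v v ≠ 0 → f v u = 0 := by
    intro v h1 h2 h3
    obtain ⟨τ, σ, hτ, hσ, hev⟩ := hσ v h1 h2 h3
    have l1 := ((lim f hτ (tendsto_const_nhds (x := u))).const_mul 2).add (hσ.mul_const (f u u))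
    have := tendsto_nhds_unique (l1.congr' (hev.mono fun ε h => h.2.2.2)) tendsto_const_nhds
    linarith
  obtain ⟨v₁, h1, h2, h3⟩ := hgT
  have hu : ∀ v, f z v = 0 → g z v = 0 → f v u = 0 := by
    intro v k1 k2
    by_cases hp : g (v + v₁) (v + v₁) = 0
    · have hm : g (v - v₁) (v - v₁) ≠ 0 ∨ g v v ≠ 0 := by
        by_contra! hcon
        obtain ⟨c1, c2⟩ := hcon
        simp [c2] at c1 hp
        exact h3 (by linarith)
      rcases hm with hm | hm
      · have := hu' _ (by simp [h1, k1]) (by simp [h2, k2]) hm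
        simpa [hu' v₁ h1 h2 h3] using this
      · exact hu' v k1 k2 hm
    · have := hu' _ (by simp [h1, k1]) (by simp [h2, k2]) hp
      simpa [hu' v₁ h1 h2 h3] using this
  have huu : f u u = 0 := by
    obtain ⟨τ, σ, -, -, hev⟩ := hσ v₁ h1 h2 h3
    obtain ⟨ε, e1, e2, e3, e4⟩ := hev.exists
    rw [hu _ e1 e2] at e4
    simpa [e3] using e4
  intro x hx
  have t1 : f z (x - g z x • u) = 0 := by simp [hx, hfu]
  have t2 : g z (x - g z x • u) = 0 := by simp [hgu]
  have t3 := hT _ t1 t2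
  have t4 := hu _ t1 t2
  simp [huu, hf u x] at t3 t4
  rw [t4] at t3
  linarith

end Local

section Components

open Filter Topology

theorem span_range_le_range {E : Type*} [AddCommGroup E] [Module ℝ E]
    (f : LinearMap.BilinForm ℝ E) (x y : E) :
    Submodule.span ℝ (Set.range ![f x, f y]) ≤ LinearMap.range f := by
  rw [Submodule.span_le]
  rintro _ ⟨i, rfl⟩
  fin_cases i
  · exact ⟨x, rfl⟩
  · exact ⟨y, rfl⟩

theorem exists_hyperbolic_pair {E : Type*} [AddCommGroup E] [Module ℝ E]
    {f : LinearMap.BilinForm ℝ E} (hf : ∀ x y, f x y = f y x) (hpos : ∃ x, 0 < f x x)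
    (hneg : ∃ y, f y y < 0) :
    ∃ x y, f x x = 0 ∧ f y y = 0 ∧ f x y ≠ 0 ∧ LinearIndependent ℝ ![f x, f y] := by
  obtain ⟨x, hx⟩ := hpos
  obtain ⟨y, hy⟩ := hneg
  obtain ⟨s, t, -, -, h1, h2, h3, -⟩ := exists_isotropic_pair hf hx hy
  refine ⟨_, _, h1, h2, h3, linearIndependent_pair_of_det_ne_zero (u := x + s • y)
    (v := x + t • y) ?_⟩
  rw [h1, h2, hf (x + t • y) (x + s • y)]
  simpa using h3

variable {E : Type*} [NormedAddCommGroup E] [NormedSpace ℝ E] [FiniteDimensional ℝ E]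

theorem two_le_finrank_range {f : LinearMap.BilinForm ℝ E} (hf : ∀ x y, f x y = f y x)
    (hpos : ∃ x, 0 < f x x) (hneg : ∃ y, f y y < 0) :
    2 ≤ Module.finrank ℝ (LinearMap.range f) := by
  obtain ⟨x, y, -, -, -, hli⟩ := exists_hyperbolic_pair hf hpos hneg
  have := Submodule.finrank_mono (span_range_le_range f x y)
  rwa [finrank_span_eq_card hli, Fintype.card_fin] at this

/-- The quadratic form of an indefinite form of rank two is a product of two linear forms, so a
connected set of isotropic vectors outside the radical lies in a hyperplane. -/
theorem span_ne_top_of_finrank_eq_two {f : LinearMap.BilinForm ℝ E} (hf : ∀ x y, f x y = f y x)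
    (hpos : ∃ x, 0 < f x x) (hneg : ∃ y, f y y < 0)
    (hrank : Module.finrank ℝ (LinearMap.range f) = 2) {C : Set E} (hC : IsPreconnected C)
    (h : ∀ v ∈ C, f v v = 0 ∧ f v ≠ 0) : Submodule.span ℝ C ≠ ⊤ := by
  obtain ⟨x, y, hx, hy, hxy, hli⟩ := exists_hyperbolic_pair hf hpos hneg
  have hrange : Submodule.span ℝ (Set.range ![f x, f y]) = LinearMap.range f :=
    Submodule.eq_of_le_of_finrank_eq (span_range_le_range f x y) (by
      rw [finrank_span_eq_card hli, Fintype.card_fin, hrank])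
  have hprod : ∀ v ∈ C, (f x v = 0 ∧ f y v ≠ 0) ∨ (f x v ≠ 0 ∧ f y v = 0) := by
    intro v hv
    obtain ⟨h1, h2⟩ := h v hv
    have hmem : f v ∈ Submodule.span ℝ (Set.range ![f x, f y]) := by
      rw [hrange]; exact ⟨v, rfl⟩
    rw [Matrix.range_cons_cons_empty, Submodule.mem_span_pair] at hmem
    obtain ⟨a, b, hab⟩ := hmem
    have hvx : f x v = b * f x y := by rw [hf, ← hab]; simp [hx, hf y x]
    have hvy : f y v = a * f x y := by rw [hf, ← hab]; simp [hy]
    have hvv : a * b * f x y = 0 := by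
      rw [← hab] at h1
      simp [hvx, hvy] at h1
      linarith
    rw [hvx, hvy]
    rcases eq_or_ne a 0 with ha | ha <;> rcases eq_or_ne b 0 with hb | hb
    · exact absurd (by rw [← hab, ha, hb]; simp) h2
    · right; simp [ha, hb, hxy]
    · left; simp [ha, hb, hxy]
    · simp [ha, hb, hxy] at hvv
  have hfx : f x ≠ 0 := fun h0 => hxy (by rw [h0]; rfl)
  have hfy : f y ≠ 0 := fun h0 => hxy (by rw [hf, h0]; rfl)
  have hker : ∀ ℓ : E →ₗ[ℝ] ℝ, ℓ ≠ 0 → (∀ v ∈ C, ℓ v = 0) → Submodule.span ℝ C ≠ ⊤ := by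
    intro ℓ hℓ h0 htop
    have hle : Submodule.span ℝ C ≤ LinearMap.ker ℓ := Submodule.span_le.2 h0
    rw [htop, top_le_iff, LinearMap.ker_eq_top] at hle
    exact hℓ hle
  by_cases hall : ∀ v ∈ C, f x v = 0
  · exact hker _ hfx hall
  · push Not at hall
    obtain ⟨v, hv, hxv⟩ := hall
    refine hker _ hfy fun w hw => ?_
    have hcont : ∀ p : E →ₗ[ℝ] ℝ, Continuous p := fun p => p.continuous_of_finiteDimensional
    by_contra hyw
    obtain ⟨c, hc, h1, h2⟩ := hC {w | f x w ≠ 0} {w | f y w ≠ 0}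
      (isOpen_ne_fun (hcont _) continuous_const) (isOpen_ne_fun (hcont _) continuous_const)
      (fun c hc => (hprod c hc).elim (fun h => Or.inr h.2) fun h => Or.inl h.1)
      ⟨v, hv, hxv⟩ ⟨w, hw, hyw⟩
    exact (hprod c hc).elim (fun h => h1 h.1) fun h => h2 h.2

theorem finrank_range_le_of_span_ne_top {f g : LinearMap.BilinForm ℝ E}
    (hf : ∀ x y, f x y = f y x) (hg : ∀ x y, g x y = g y x) {z : E}
    (hz : z ∈ regularZeros f g)
    (hspan : Submodule.span ℝ (connectedComponentIn (regularZeros f g) z) ≠ ⊤) :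
    (∃ a b : ℝ, (a ≠ 0 ∨ b ≠ 0) ∧ Module.finrank ℝ (LinearMap.range (a • f + b • g)) ≤ 2) ∨
      ∀ a b : ℝ, Module.finrank ℝ (LinearMap.range (a • f + b • g)) ≤ 4 := by
  obtain ⟨ℓ, hℓ, hle⟩ := Submodule.exists_le_ker_of_lt_top _ hspan.lt_top
  have hℓ0 : ∀ x ∈ connectedComponentIn (regularZeros f g) z, ℓ x = 0 :=
    fun x hx => hle (Submodule.subset_span hx)
  have htan : ∀ v, f z v = 0 → g z v = 0 → ℓ v = 0 := by
    intro v h1 h2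
    obtain ⟨γ, hγ0, hder, hev⟩ := exists_curve hf hg hz h1 h2
    have hd : HasDerivAt (fun ε => ℓ (γ ε)) (ℓ v) 0 :=
      (LinearMap.toContinuousLinearMap ℓ).hasFDerivAt.comp_hasDerivAt (0 : ℝ) hder
    exact hd.unique ((hasDerivAt_const (0 : ℝ) (0 : ℝ)).congr_of_eventuallyEq
      (hev.mono fun ε h => hℓ0 _ h))
  obtain ⟨a, b, hab⟩ := mem_span_pair_of_ker htan
  obtain ⟨hfz, hgz, hli⟩ := hz
  have hne : a ≠ 0 ∨ b ≠ 0 := by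
    by_contra! h
    exact hℓ (by rw [hab, h.1, h.2]; simp)
  have hab0 : 0 < a ^ 2 + b ^ 2 := by
    rcases hne with h | h <;> positivity
  set F : LinearMap.BilinForm ℝ E := a • f + b • g with hF
  set G : LinearMap.BilinForm ℝ E := -b • f + a • g with hG
  have hFs : ∀ u v, F u v = F v u := fun u v => by simp [hF, hf u v, hg u v]
  have hGs : ∀ u v, G u v = G v u := fun u v => by simp [hG, hf u v, hg u v]
  have hFz : F z = ℓ := hab.symm
  have hFzz : F z z = 0 := by simp [hF, hfz, hgz]
  have hGzz : G z z = 0 := by simp [hG, hfz, hgz]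
  obtain ⟨u, w, hFu, hGu, hFw, hGw⟩ : ∃ u w, F z u = 1 ∧ G z u = 0 ∧ F z w = 0 ∧ G z w = 1 := by
    apply exists_dual_pair
    rw [LinearIndependent.pair_iff]
    intro s t hst
    obtain ⟨h1, h2⟩ := LinearIndependent.pair_iff.1 hli (s * a - t * b) (s * b + t * a) (by
      rw [← hst]
      ext v
      simp [hF, hG]; ring)
    constructor
    · have : (a ^ 2 + b ^ 2) * s = 0 := by linear_combination a * h1 + b * h2
      simpa [hab0.ne'] using this
    · have : (a ^ 2 + b ^ 2) * t = 0 := by linear_combination a * h2 - b * h1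
      simpa [hab0.ne'] using this
  have hfFG : ∀ u v, f u v = (a * F u v - b * G u v) / (a ^ 2 + b ^ 2) := fun u v => by
    rw [eq_div_iff hab0.ne']; simp [hF, hG]; ring
  have hgFG : ∀ u v, g u v = (b * F u v + a * G u v) / (a ^ 2 + b ^ 2) := fun u v => by
    rw [eq_div_iff hab0.ne']; simp [hF, hG]; ring
  rcases vanish_of_curves hFs hGs hFzz hGzz hFw hGw (fun v h1 h2 => by
    obtain ⟨γ, hγ0, hder, hev⟩ := exists_curve hf hg ⟨hfz, hgz, hli⟩
      (v := v) (by rw [hfFG, h1, h2]; simp) (by rw [hgFG, h1, h2]; simp)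
    refine ⟨γ, hγ0, hder, hev.mono fun ε h => ?_⟩
    obtain ⟨e1, e2, -⟩ := connectedComponentIn_subset _ _ h
    exact ⟨by simp [hF, e1, e2], by simp [hG, e1, e2], by rw [hFz, hℓ0 _ h]⟩) with hcase | hcase
  · left
    exact ⟨a, b, hne, finrank_range_le_two_of_hyperplane hFu fun x y hx hy =>
      polarization hFs (S := LinearMap.ker (F z)) hcase hx hy⟩
  · right
    intro c d
    refine finrank_range_le_four_of_codim_two hFu hGu hFw hGw fun x y h1 h2 h3 h4 => ?_
    have hS : ∀ x ∈ LinearMap.ker (F z) ⊓ LinearMap.ker (G z), F x x = 0 ∧ G x x = 0 :=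
      fun x hx => hcase x hx.1 hx.2
    have k1 := polarization hFs (fun x hx => (hS x hx).1) (x := x) (y := y) ⟨h1, h2⟩ ⟨h3, h4⟩
    have k2 := polarization hGs (fun x hx => (hS x hx).2) (x := x) (y := y) ⟨h1, h2⟩ ⟨h3, h4⟩
    simp [hfFG x y, hgFG x y, k1, k2]

end Components

section Matrices

variable {n : ℕ}

theorem toBilin'_symm {F : Matrix (Fin n) (Fin n) ℝ} (hF : F.IsSymm) (x y : Fin n → ℝ) :
    toBilin' F x y = toBilin' F y x := by
  rw [toBilin'_apply', toBilin'_apply', dotProduct_mulVec, ← mulVec_transpose, hF.eq,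
    dotProduct_comm]

theorem toBilin'_apply_eq_zero_iff {F : Matrix (Fin n) (Fin n) ℝ} (hF : F.IsSymm)
    (x : Fin n → ℝ) : toBilin' F x = 0 ↔ F *ᵥ x = 0 := by
  constructor
  · intro h
    refine dotProduct_eq_zero _ fun y => ?_
    rw [dotProduct_comm, ← toBilin'_apply', toBilin'_symm hF, h]
    rfl
  · intro h
    ext y
    rw [LinearMap.comp_apply, toBilin'_symm hF, toBilin'_apply', h]
    simp

theorem rank_eq_finrank_range_toBilin' {F : Matrix (Fin n) (Fin n) ℝ} (hF : F.IsSymm) :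
    F.rank = Module.finrank ℝ (LinearMap.range (toBilin' F)) := by
  have hker : LinearMap.ker (toBilin' F) = LinearMap.ker F.mulVecLin := by
    ext x
    simpa using toBilin'_apply_eq_zero_iff hF x
  have h1 := (toBilin' F).finrank_range_add_finrank_ker
  have h2 := F.mulVecLin.finrank_range_add_finrank_ker
  rw [hker] at h1
  rw [Matrix.rank]
  omega

theorem regularZeros_toBilin' {A B : Matrix (Fin n) (Fin n) ℝ} (hA : A.IsSymm) (hB : B.IsSymm) :
    {z : Fin n → ℝ | z ⬝ᵥ A.mulVec z = 0 ∧ z ⬝ᵥ B.mulVec z = 0 ∧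
      LinearIndependent ℝ ![A.mulVec z, B.mulVec z]} =
    regularZeros (toBilin' A) (toBilin' B) := by
  ext z
  have h : ∀ s t : ℝ, s • toBilin' A z + t • toBilin' B z = 0 ↔ s • A *ᵥ z + t • B *ᵥ z = 0 := by
    intro s t
    have := toBilin'_apply_eq_zero_iff ((hA.smul s).add (hB.smul t)) z
    simpa [add_mulVec, smul_mulVec] using this
  simp only [regularZeros, Set.mem_ofPred_eq, toBilin'_apply', LinearIndependent.pair_iff, h]

end Matrices

/-- **Lemma 3.13.** Let `A, B ∈ Sym(n,ℝ)` be linearly independent, forming a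
non-dissipative pair with `maxrank{A,B} ≥ 9`. Then the following are equivalent:
(i) some connected component of `𝒩` does not span `ℝⁿ`;
(ii) no connected component of `𝒩` spans `ℝⁿ`;
(iii) `minrank{A,B} = 2`. -/
theorem component_span_tfae {n : ℕ}
    (A B : Matrix (Fin n) (Fin n) ℝ) (hAs : A.IsSymm) (hBs : B.IsSymm)
    (hind : LinearIndependent ℝ ![A, B])
    (hnd : ∀ F ∈ Submodule.span ℝ ({A, B} : Set (Matrix (Fin n) (Fin n) ℝ)),
      F.PosSemidef → F = 0)
    (hrank : ∃ F ∈ Submodule.span ℝ ({A, B} : Set (Matrix (Fin n) (Fin n) ℝ)), 9 ≤ F.rank)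
    (N : Set (Fin n → ℝ))
    (hN : N = {z : Fin n → ℝ | z ⬝ᵥ A.mulVec z = 0 ∧ z ⬝ᵥ B.mulVec z = 0 ∧
      LinearIndependent ℝ ![A.mulVec z, B.mulVec z]}) :
    ((∃ z ∈ N, Submodule.span ℝ (connectedComponentIn N z) ≠ ⊤) ↔
      (∀ z ∈ N, Submodule.span ℝ (connectedComponentIn N z) ≠ ⊤)) ∧
    ((∀ z ∈ N, Submodule.span ℝ (connectedComponentIn N z) ≠ ⊤) ↔
      ((∃ F ∈ Submodule.span ℝ ({A, B} : Set (Matrix (Fin n) (Fin n) ℝ)),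
          F ≠ 0 ∧ F.rank = 2) ∧
        (∀ F ∈ Submodule.span ℝ ({A, B} : Set (Matrix (Fin n) (Fin n) ℝ)),
          F ≠ 0 → 2 ≤ F.rank))) := by
  have hN' : N = regularZeros (toBilin' A) (toBilin' B) := hN.trans (regularZeros_toBilin' hAs hBs)
  clear hN
  subst hN'
  have hsymm : ∀ a b : ℝ, (a • A + b • B).IsSymm := fun a b => (hAs.smul a).add (hBs.smul b)
  have hA := toBilin'_symm hAs
  have hB := toBilin'_symm hBs
  have hlin : ∀ a b : ℝ, toBilin' (a • A + b • B) = a • toBilin' A + b • toBilin' B :=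
    fun a b => by simp
  have hmem : ∀ a b : ℝ, a • A + b • B ∈ Submodule.span ℝ {A, B} :=
    fun a b => Submodule.mem_span_pair.2 ⟨a, b, rfl⟩
  have hrk : ∀ a b : ℝ, (a • A + b • B).rank =
      Module.finrank ℝ (LinearMap.range (a • toBilin' A + b • toBilin' B)) := fun a b => by
    rw [rank_eq_finrank_range_toBilin' (hsymm a b), hlin]
  have hne : ∀ a b : ℝ, a ≠ 0 ∨ b ≠ 0 → a • A + b • B ≠ 0 := by
    intro a b hab h0
    obtain ⟨h1, h2⟩ := LinearIndependent.pair_iff.1 hind a b h0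
    tauto
  have hnd' : ∀ F ∈ Submodule.span ℝ ({A, B} : Set (Matrix (Fin n) (Fin n) ℝ)),
      (∀ x, 0 ≤ toBilin' F x x) → F = 0 := by
    intro F hF h
    obtain ⟨a, b, rfl⟩ := Submodule.mem_span_pair.1 hF
    refine hnd _ hF (PosSemidef.of_dotProduct_mulVec_nonneg ?_ fun x => ?_)
    · rw [IsHermitian, conjTranspose_eq_transpose_of_trivial]
      exact hsymm a b
    · simpa only [star_trivial, toBilin'_apply'] using h x
  have hneg : ∀ F ∈ Submodule.span ℝ ({A, B} : Set (Matrix (Fin n) (Fin n) ℝ)), F ≠ 0 →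
      ∃ y, toBilin' F y y < 0 := by
    intro F hF hF0
    by_contra! h
    exact hF0 (hnd' F hF h)
  have hpos : ∀ F ∈ Submodule.span ℝ ({A, B} : Set (Matrix (Fin n) (Fin n) ℝ)), F ≠ 0 →
      ∃ y, 0 < toBilin' F y y := by
    intro F hF hF0
    obtain ⟨y, hy⟩ := hneg (-F) (neg_mem hF) (neg_ne_zero.2 hF0)
    exact ⟨y, by simpa using hy⟩
  have hspan_symm : ∀ F ∈ Submodule.span ℝ ({A, B} : Set (Matrix (Fin n) (Fin n) ℝ)),
      F.IsSymm := by
    intro F hF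
    obtain ⟨a, b, rfl⟩ := Submodule.mem_span_pair.1 hF
    exact hsymm a b
  have htwo : ∀ F ∈ Submodule.span ℝ ({A, B} : Set (Matrix (Fin n) (Fin n) ℝ)), F ≠ 0 →
      2 ≤ F.rank := by
    intro F hF hF0
    rw [rank_eq_finrank_range_toBilin' (hspan_symm F hF)]
    exact two_le_finrank_range (toBilin'_symm (hspan_symm F hF)) (hpos F hF hF0) (hneg F hF hF0)
  obtain ⟨F₀, hF₀, hrank₀⟩ := hrank
  obtain ⟨a, b, rfl⟩ := Submodule.mem_span_pair.1 hF₀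
  have hnonempty : ∃ z, z ∈ regularZeros (toBilin' A) (toBilin' B) := by
    have hab0 : 0 < a ^ 2 + b ^ 2 := by
      by_contra! h
      have h1 : a = 0 := by nlinarith [sq_nonneg a, sq_nonneg b]
      have h2 : b = 0 := by nlinarith [sq_nonneg a, sq_nonneg b]
      simp [h1, h2] at hrank₀
    have hcomb : ∀ c d : ℝ, c • (a • A + b • B) + d • (-b • A + a • B) =
        (c * a - d * b) • A + (c * b + d * a) • B := fun c d => by
      module
    obtain ⟨z, hz1, hz2, hz3⟩ := exists_regular_zero (f := toBilin' (a • A + b • B))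
      (g := toBilin' (-b • A + a • B)) (toBilin'_symm (hsymm _ _)) (toBilin'_symm (hsymm _ _))
      (fun c d hcd => by
        have h0 := hnd' (c • (a • A + b • B) + d • (-b • A + a • B))
          (add_mem (Submodule.smul_mem _ _ (hmem _ _)) (Submodule.smul_mem _ _ (hmem _ _)))
          (fun x => by
            rw [map_add, map_smul, map_smul]
            exact hcd x)
        rw [hcomb] at h0
        obtain ⟨h1, h2⟩ := LinearIndependent.pair_iff.1 hind _ _ h0
        constructor
        · have : (a ^ 2 + b ^ 2) * c = 0 := by linear_combination a * h1 + b * h2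
          simpa [hab0.ne'] using this
        · have : (a ^ 2 + b ^ 2) * d = 0 := by linear_combination a * h2 - b * h1
          simpa [hab0.ne'] using this)
      (fun x y => by
        by_contra! hcon
        have := finrank_range_le_two_of_ker (toBilin'_symm (hsymm a b)) hcon
        rw [← rank_eq_finrank_range_toBilin' (hsymm a b)] at this
        omega)
    rw [hlin, hlin] at hz3
    simp only [hlin, LinearMap.add_apply, LinearMap.smul_apply, smul_eq_mul] at hz1 hz2 hz3
    refine ⟨z, ?_, ?_, ?_⟩
    · have : (a ^ 2 + b ^ 2) * toBilin' A z z = 0 := by linear_combination a * hz1 - b * hz2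
      simpa only [mul_eq_zero, hab0.ne', false_or] using this
    · have : (a ^ 2 + b ^ 2) * toBilin' B z z = 0 := by linear_combination b * hz1 + a * hz2
      simpa only [mul_eq_zero, hab0.ne', false_or] using this
    · rw [LinearIndependent.pair_iff] at hz3 ⊢
      intro s t hst
      obtain ⟨h1, h2⟩ := hz3 (s * a + t * b) (t * a - s * b) (by
        trans (a ^ 2 + b ^ 2) • (s • toBilin' A z + t • toBilin' B z)
        · module
        · rw [hst, smul_zero])
      constructor
      · have : (a ^ 2 + b ^ 2) * s = 0 := by linear_combination a * h1 - b * h2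
        simpa [hab0.ne'] using this
      · have : (a ^ 2 + b ^ 2) * t = 0 := by linear_combination b * h1 + a * h2
        simpa [hab0.ne'] using this
  have h31 : (∃ F ∈ Submodule.span ℝ ({A, B} : Set (Matrix (Fin n) (Fin n) ℝ)),
      F ≠ 0 ∧ F.rank = 2) → ∀ z ∈ regularZeros (toBilin' A) (toBilin' B),
      Submodule.span ℝ (connectedComponentIn (regularZeros (toBilin' A) (toBilin' B)) z) ≠ ⊤ := by
    rintro ⟨F, hF, hF0, hF2⟩ z hz
    rw [rank_eq_finrank_range_toBilin' (hspan_symm F hF)] at hF2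
    refine span_ne_top_of_finrank_eq_two (toBilin'_symm (hspan_symm F hF)) (hpos F hF hF0)
      (hneg F hF hF0) hF2 isPreconnected_connectedComponentIn fun v hv => ?_
    obtain ⟨h1, h2, h3⟩ := connectedComponentIn_subset _ _ hv
    obtain ⟨c, d, rfl⟩ := Submodule.mem_span_pair.1 hF
    rw [hlin]
    refine ⟨by simp only [LinearMap.add_apply, LinearMap.smul_apply, h1, h2]; simp, fun h0 => ?_⟩
    obtain ⟨rfl, rfl⟩ := LinearIndependent.pair_iff.1 h3 c d h0
    simp at hF0
  have h13 : (∃ z ∈ regularZeros (toBilin' A) (toBilin' B),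
      Submodule.span ℝ (connectedComponentIn (regularZeros (toBilin' A) (toBilin' B)) z) ≠ ⊤) →
      ∃ F ∈ Submodule.span ℝ ({A, B} : Set (Matrix (Fin n) (Fin n) ℝ)), F ≠ 0 ∧ F.rank = 2 := by
    rintro ⟨z, hz, hspan⟩
    rcases finrank_range_le_of_span_ne_top hA hB hz hspan with ⟨c, d, hcd, hle⟩ | hle
    · rw [← hrk] at hle
      exact ⟨_, hmem c d, hne c d hcd, le_antisymm hle (htwo _ (hmem c d) (hne c d hcd))⟩
    · have := hle a b
      rw [← hrk] at this
      omega
  obtain ⟨z₀, hz₀⟩ := hnonempty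
  exact ⟨⟨fun h => h31 (h13 h), fun h => ⟨z₀, hz₀, h z₀ hz₀⟩⟩,
    fun h => ⟨h13 ⟨z₀, hz₀, h z₀ hz₀⟩, htwo⟩, fun h => h31 h.1⟩
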